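/- arXiv:2503.19766 — 7 statements merged into one kernel-verified Lean document; each statement's English description precedes it below -/
import Mathlib

section
/- Let A₁ = {t ≥ 0 : g(t+s) > g(t) for all s ∈ (0, T^Σ_ℓ]}, A₂ = {t ≥ 0 : g(t+s) > g(t) for all s ∈ (0, ∞)}, and A₃ = {t ≥ 0 : there exists γ > 0 such that g(t+s) > g(t) + γ·s for all s ∈ (0, ∞)}. Then A₁ = A₂ = A₃. -/
/- Context: ℓ ≥ 1 phases, phase lengths T i > 0 (i = 1,…,ℓ) with partial sums
`Tcum j = ∑_{i=1}^j T i`, phase values `rv i`, and `r : ℝ → ℝ` the `Tcum ℓ`-periodic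
function equal to `rv i` on `[Tcum (i-1), Tcum i)`, with `g t = ∫_0^t r`. -/

theorem stmt_0
    (ℓ : ℕ) (hℓ : 1 ≤ ℓ)
    (T rv : ℕ → ℝ)
    (hT : ∀ i, 1 ≤ i → i ≤ ℓ → 0 < T i)
    (Tcum : ℕ → ℝ)
    (hTcum : ∀ j, Tcum j = ∑ i ∈ Finset.Icc 1 j, T i)
    (r : ℝ → ℝ)
    (hper : ∀ t : ℝ, r (t + Tcum ℓ) = r t)
    (hstep : ∀ i, 1 ≤ i → i ≤ ℓ → ∀ t : ℝ, Tcum (i - 1) ≤ t → t < Tcum i → r t = rv i)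
    (g : ℝ → ℝ)
    (hg : ∀ t : ℝ, g t = ∫ u in (0:ℝ)..t, r u) :
    ({t : ℝ | 0 ≤ t ∧ ∀ s : ℝ, 0 < s → s ≤ Tcum ℓ → g t < g (t + s)} =
       {t : ℝ | 0 ≤ t ∧ ∀ s : ℝ, 0 < s → g t < g (t + s)}) ∧
    ({t : ℝ | 0 ≤ t ∧ ∀ s : ℝ, 0 < s → g t < g (t + s)} =
       {t : ℝ | 0 ≤ t ∧ ∃ γ : ℝ, 0 < γ ∧ ∀ s : ℝ, 0 < s → g t + γ * s < g (t + s)}) := by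
  have hsucc : ∀ j, Tcum (j+1) = Tcum j + T (j+1) := by
    intro j
    rw [hTcum, hTcum, Finset.sum_Icc_succ_top (by omega)]
  have h0 : Tcum 0 = 0 := by simp [hTcum]
  have hnn : ∀ j, j ≤ ℓ → 0 ≤ Tcum j := by
    intro j hj
    rw [hTcum]
    refine Finset.sum_nonneg fun i hi => ?_
    rw [Finset.mem_Icc] at hi
    exact (hT i hi.1 (hi.2.trans hj)).le
  have hP : 0 < Tcum ℓ := by
    obtain ⟨k, rfl⟩ : ∃ k, ℓ = k + 1 := ⟨ℓ - 1, by omega⟩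
    rw [hsucc]
    have := hnn k (by omega)
    have := hT (k+1) (by omega) le_rfl
    linarith
  have hint0 : ∀ j, j ≤ ℓ → IntervalIntegrable r MeasureTheory.volume 0 (Tcum j) := by
    intro j
    induction j with
    | zero => intro _; rw [h0]
    | succ k ih =>
      intro hk
      refine (ih (by omega)).trans ?_
      have hlt : Tcum k ≤ Tcum (k+1) := by
        rw [hsucc]; have := hT (k+1) (by omega) hk; linarith
      refine IntervalIntegrable.congr_uIoo (f := fun _ => rv (k+1)) intervalIntegrable_const ?_
      intro x hx
      rw [Set.uIoo_of_le hlt] at hx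
      exact (hstep (k+1) (by omega) hk x hx.1.le hx.2).symm
  have hperf : Function.Periodic r (Tcum ℓ) := hper
  have hint : ∀ a b, IntervalIntegrable r MeasureTheory.volume a b := by
    intro a b
    exact hperf.intervalIntegrable₀ hP.ne' (hint0 ℓ le_rfl) a b
  have hdiff : ∀ a b, g b - g a = ∫ u in a..b, r u := by
    intro a b
    rw [hg, hg, intervalIntegral.integral_interval_sub_left (hint _ _) (hint _ _)]
  have hcont : Continuous g := by
    have : g = fun t => ∫ u in (0:ℝ)..t, r u := funext hg
    rw [this]
    exact intervalIntegral.continuous_primitive hint 0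
  have hgP : ∀ t, g (t + Tcum ℓ) = g t + g (Tcum ℓ) := by
    intro t
    have h1 := hdiff t (t + Tcum ℓ)
    have h2 := hperf.intervalIntegral_add_eq t 0
    rw [zero_add, ← hg] at h2
    linarith
  have hfind : ∀ j, j ≤ ℓ → ∀ t, 0 ≤ t → t < Tcum j →
      ∃ i, 1 ≤ i ∧ i ≤ ℓ ∧ Tcum (i-1) ≤ t ∧ t < Tcum i := by
    intro j
    induction j with
    | zero => intro _ t h1 h2; linarith
    | succ k ih =>
      intro hk t h1 h2
      by_cases h : t < Tcum k
      · exact ih (by omega) t h1 h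
      · exact ⟨k+1, by omega, hk, by simpa using h, h2⟩
  have hloc : ∀ t, ∃ ε v : ℝ, 0 < ε ∧ ∀ s, 0 ≤ s → s ≤ ε → g (t + s) = g t + v * s := by
    intro t
    obtain ⟨m, hm, -⟩ := existsUnique_sub_zsmul_mem_Ico hP t 0
    rw [zero_add] at hm
    obtain ⟨i, hi1, hi2, h3, h4⟩ := hfind ℓ le_rfl _ hm.1 hm.2
    refine ⟨Tcum i - (t - m • Tcum ℓ), rv i, by linarith, ?_⟩
    intro s hs0 hs
    have h5 := hdiff t (t + s)
    have h6 : ∫ u in t..(t+s), r u = ∫ u in t..(t+s), rv i := by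
      refine intervalIntegral.integral_congr_uIoo ?_
      intro x hx
      rw [Set.uIoo_of_le (by linarith)] at hx
      have h7 := hperf.sub_zsmul_eq m (x := x)
      change r x = rv i
      rw [← h7]
      exact hstep i hi1 hi2 _ (by linarith [hx.1]) (by linarith [hx.2])
    rw [h6, intervalIntegral.integral_const, smul_eq_mul] at h5
    linarith
  have key : ∀ t, (∀ s : ℝ, 0 < s → s ≤ Tcum ℓ → g t < g (t + s)) →
      ∃ γ : ℝ, 0 < γ ∧ ∀ s : ℝ, 0 < s → g t + γ * s < g (t + s) := by
    intro t ht
    obtain ⟨ε, v, hε, hv⟩ := hloc t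
    have hvpos : 0 < v := by
      have hd : 0 < min ε (Tcum ℓ) := lt_min hε hP
      have h1 := ht _ hd (min_le_right _ _)
      rw [hv _ hd.le (min_le_left _ _)] at h1
      by_contra hneg
      have := mul_nonneg (sub_nonneg.2 (not_lt.1 hneg)) hd.le
      linarith
    obtain ⟨m, hm, hmle⟩ : ∃ m : ℝ, 0 < m ∧ ∀ s, ε ≤ s → s ≤ Tcum ℓ → g t + m ≤ g (t + s) := by
      by_cases hle : ε ≤ Tcum ℓ
      · obtain ⟨x, hx, hmin⟩ := isCompact_Icc.exists_isMinOn (Set.nonempty_Icc.2 hle)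
          (f := fun s => g (t + s)) (by fun_prop)
        refine ⟨g (t + x) - g t, by linarith [ht x (by linarith [hx.1]) hx.2], ?_⟩
        intro s h1 h2
        have := hmin (Set.mem_Icc.2 ⟨h1, h2⟩)
        simp only [Set.mem_ofPred_eq] at this
        linarith
      · exact ⟨1, one_pos, fun s h1 h2 => absurd (h1.trans h2) hle⟩
    obtain ⟨γ, hγ, hγv, hγm⟩ : ∃ γ : ℝ, 0 < γ ∧ γ < v ∧ γ * Tcum ℓ < m := by
      have hq : 0 < min v (m / Tcum ℓ) := lt_min hvpos (div_pos hm hP)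
      refine ⟨min v (m / Tcum ℓ) / 2, by linarith, by linarith [min_le_left v (m / Tcum ℓ)], ?_⟩
      rw [← lt_div_iff₀ hP]
      linarith [min_le_right v (m / Tcum ℓ)]
    have hbase : ∀ s, 0 < s → s ≤ Tcum ℓ → g t + γ * s < g (t + s) := by
      intro s h1 h2
      rcases le_total s ε with h | h
      · rw [hv s h1.le h]
        have := mul_lt_mul_of_pos_right hγv h1
        linarith
      · have := hmle s h h2
        have := mul_le_mul_of_nonneg_left h2 hγ.le
        linarith
    have hind : ∀ n : ℕ, ∀ s, 0 < s → s ≤ n * Tcum ℓ → g t + γ * s < g (t + s) := by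
      intro n
      induction n with
      | zero => intro s h1 h2; simp at h2; linarith
      | succ n ih =>
        intro s h1 h2
        push_cast at h2
        by_cases h : s ≤ Tcum ℓ
        · exact hbase s h1 h
        · have h3 := ih (s - Tcum ℓ) (by linarith) (by linarith)
          have h4 := hgP (t + (s - Tcum ℓ))
          have h5 := hbase _ hP le_rfl
          rw [hgP t] at h5
          rw [show t + (s - Tcum ℓ) + Tcum ℓ = t + s by ring] at h4
          linarith
    refine ⟨γ, hγ, fun s hs => ?_⟩
    obtain ⟨n, hn⟩ := exists_nat_ge (s / Tcum ℓ)
    exact hind n s hs ((div_le_iff₀ hP).1 hn)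
  have h31 : ∀ t, (∃ γ : ℝ, 0 < γ ∧ ∀ s : ℝ, 0 < s → g t + γ * s < g (t + s)) →
      ∀ s : ℝ, 0 < s → g t < g (t + s) := by
    rintro t ⟨γ, hγ, h⟩ s hs
    linarith [h s hs, mul_pos hγ hs]
  constructor
  · ext t
    exact ⟨fun h => ⟨h.1, h31 t (key t h.2)⟩, fun h => ⟨h.1, fun s hs _ => h.2 s hs⟩⟩
  · ext t
    exact ⟨fun h => ⟨h.1, key t fun s hs _ => h.2 s hs⟩, fun h => ⟨h.1, h31 t h.2⟩⟩
end

section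
/- Assume r_i ≠ 0 for every i = 1, …, ℓ. Define A = {t ≥ 0 : g(t+s) > g(t) for all s ∈ (0, T^Σ_ℓ]} and Ã = {t ≥ 0 : there exists s ∈ (0, T^Σ_ℓ] with g(t+s) < g(t)}. Then the complement [0,∞) \ (A ∪ Ã) has Lebesgue measure zero. -/
open Set Filter Topology MeasureTheory

theorem aux_level_countable (g r : ℝ → ℝ) (C : Set ℝ) (hC : C.Countable)
    (hd : ∀ t, t ∉ C → HasDerivAt g (r t) t) (hr : ∀ t, r t ≠ 0) (c : ℝ) :
    {t | g t = c}.Countable := by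
  set L : Set ℝ := {t | g t = c} with hL
  have h1 := countable_setOfPred_isolated_right_within (s := L)
  refine (hC.union h1).mono ?_
  intro t ht
  by_cases htC : t ∈ C
  · exact Or.inl htC
  · refine Or.inr ⟨ht, ?_⟩
    have h2 : ∀ᶠ z in 𝓝[≠] t, g z ≠ c := (hd t htC).eventually_ne (hr t)
    have h3 : ∀ᶠ z in 𝓝[>] t, g z ≠ c :=
      h2.filter_mono (nhdsWithin_mono _ (fun x (hx : t < x) => ne_of_gt hx))
    change 𝓝[L ∩ Ioi t] t = ⊥
    rw [inter_comm, nhdsWithin_inter', ← empty_mem_iff_bot]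
    filter_upwards [h3.filter_mono inf_le_left,
      (mem_inf_of_right (mem_principal_self L) : L ∈ 𝓝[>] t ⊓ 𝓟 L)] with x hx hx2
    exact hx hx2

theorem aux_bad_countable (g r : ℝ → ℝ) (C : Set ℝ) (hC : C.Countable) (P : ℝ) (hP : 0 < P)
    (hd : ∀ t, t ∉ C → HasDerivAt g (r t) t) (hr : ∀ t, r t ≠ 0)
    (hper : ∀ t, r (t + P) = r t) :
    {t | (∀ s, 0 < s → s ≤ P → g t ≤ g (t + s)) ∧
      ∃ s, 0 < s ∧ s ≤ P ∧ g (t + s) = g t}.Countable := by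
  have h1 : (C ∪ ⋃ c ∈ C, {t | g t = g c}).Countable :=
    hC.union (hC.biUnion fun c _ => aux_level_countable g r C hC hd hr (g c))
  refine h1.mono ?_
  rintro t ⟨hmin, s, hs0, hsP, hs⟩
  by_cases htC : t ∈ C
  · exact Or.inl htC
  refine Or.inr ?_
  simp only [mem_iUnion, mem_ofPred_eq, exists_prop]
  refine ⟨t + s, ?_, hs.symm⟩
  by_contra hn
  rcases hsP.lt_or_eq with hlt | rfl
  · refine hr (t + s) (IsLocalMin.hasDerivAt_eq_zero (f := g) (a := t + s) ?_ (hd _ hn))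
    have : Ioo t (t + P) ∈ 𝓝 (t + s) := Ioo_mem_nhds (by linarith) (by linarith)
    filter_upwards [this] with x hx
    have := hmin (x - t) (by linarith [hx.1]) (by linarith [hx.2])
    rw [add_sub_cancel] at this
    linarith
  · have d1 := (hd t htC).tendsto_slope_zero_right
    have d2 := (hd _ hn).tendsto_slope_zero_left
    rw [hper] at d2
    have p1 : 0 ≤ r t := by
      refine ge_of_tendsto d1 ?_
      filter_upwards [Ioo_mem_nhdsGT hP] with x hx
      have := hmin x hx.1 hx.2.le
      exact mul_nonneg (inv_nonneg.2 hx.1.le) (by linarith)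
    have p2 : r t ≤ 0 := by
      refine le_of_tendsto d2 ?_
      filter_upwards [Ioo_mem_nhdsLT (neg_lt_zero.2 hP)] with x hx
      have := hmin (s + x) (by linarith [hx.1]) (by linarith [hx.2])
      rw [← add_assoc] at this
      exact mul_nonpos_of_nonpos_of_nonneg (inv_nonpos.2 hx.2.le) (by linarith)
    exact hr t (le_antisymm p2 p1)

theorem stmt_2
    (ℓ : ℕ) (hℓ : 1 ≤ ℓ)
    (T rv : ℕ → ℝ)
    (hT : ∀ i, 1 ≤ i → i ≤ ℓ → 0 < T i)
    (hrv : ∀ i, 1 ≤ i → i ≤ ℓ → rv i ≠ 0)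
    (Tcum : ℕ → ℝ)
    (hTcum : ∀ j, Tcum j = ∑ i ∈ Finset.Icc 1 j, T i)
    (r : ℝ → ℝ)
    (hper : ∀ t : ℝ, r (t + Tcum ℓ) = r t)
    (hstep : ∀ i, 1 ≤ i → i ≤ ℓ → ∀ t : ℝ, Tcum (i - 1) ≤ t → t < Tcum i → r t = rv i)
    (g : ℝ → ℝ)
    (hg : ∀ t : ℝ, g t = ∫ u in (0:ℝ)..t, r u) :
    MeasureTheory.volume
      ({t : ℝ | 0 ≤ t} \
        ({t : ℝ | 0 ≤ t ∧ ∀ s : ℝ, 0 < s → s ≤ Tcum ℓ → g t < g (t + s)} ∪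
         {t : ℝ | 0 ≤ t ∧ ∃ s : ℝ, 0 < s ∧ s ≤ Tcum ℓ ∧ g (t + s) < g t})) = 0 := by
  have hT0 : Tcum 0 = 0 := by simp [hTcum]
  have hPpos : 0 < Tcum ℓ := by
    rw [hTcum]
    refine Finset.sum_pos (fun i hi => ?_) ⟨1, by simp [hℓ]⟩
    rw [Finset.mem_Icc] at hi
    exact hT i hi.1 hi.2
  have hperk : ∀ (k : ℤ) (t : ℝ), r (t - k * Tcum ℓ) = r t := fun k t =>
    Function.Periodic.sub_int_mul_eq hper k
  have key : ∀ t : ℝ, ∃ i, 1 ≤ i ∧ i ≤ ℓ ∧ ∃ k : ℤ,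
      Tcum (i - 1) + k * Tcum ℓ ≤ t ∧ t < Tcum i + k * Tcum ℓ := by
    intro t
    have hk1 := Int.floor_le (t / Tcum ℓ)
    have hk2 := Int.lt_floor_add_one (t / Tcum ℓ)
    rw [le_div_iff₀ hPpos] at hk1
    rw [div_lt_iff₀ hPpos] at hk2
    set k := ⌊t / Tcum ℓ⌋
    have hex : ∃ i, t < Tcum i + k * Tcum ℓ := ⟨ℓ, by linarith⟩
    classical
    have hi := Nat.find_spec hex
    have hmin : ∀ m, m < Nat.find hex → ¬ _ := fun m hm => Nat.find_min hex hm
    have hle : Nat.find hex ≤ ℓ := Nat.find_min' hex (by linarith)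
    have h1 : 1 ≤ Nat.find hex := by
      by_contra h0
      have h0 : Nat.find hex = 0 := by omega
      rw [h0, hT0] at hi
      linarith
    exact ⟨Nat.find hex, h1, hle, k, not_lt.1 (hmin _ (by omega)), hi⟩
  have hval : ∀ (i : ℕ), 1 ≤ i → i ≤ ℓ → ∀ (k : ℤ) (t : ℝ),
      Tcum (i - 1) + k * Tcum ℓ ≤ t → t < Tcum i + k * Tcum ℓ → r t = rv i := by
    intro i h1 h2 k t h3 h4
    rw [← hperk k t]
    exact hstep i h1 h2 _ (by linarith) (by linarith)
  have hr : ∀ t, r t ≠ 0 := by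
    intro t
    obtain ⟨i, h1, h2, k, h3, h4⟩ := key t
    rw [hval i h1 h2 k t h3 h4]
    exact hrv i h1 h2
  set C : Set ℝ := range (fun p : ℕ × ℤ => Tcum p.1 + p.2 * Tcum ℓ) with hCdef
  have hC : C.Countable := countable_range _
  have hcont : ∀ t, t ∉ C → ContinuousAt r t := by
    intro t ht
    obtain ⟨i, h1, h2, k, h3, h4⟩ := key t
    have h3' : Tcum (i - 1) + k * Tcum ℓ < t := lt_of_le_of_ne h3 fun h => ht ⟨(i - 1, k), h⟩
    have : r =ᶠ[𝓝 t] fun _ => rv i := by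
      filter_upwards [Ioo_mem_nhds h3' h4] with x hx
      exact hval i h1 h2 k x hx.1.le hx.2
    exact continuousAt_const.congr this.symm
  have hmeas : AEStronglyMeasurable r volume := by
    have h1 : ContinuousOn r Cᶜ := fun t ht => (hcont t ht).continuousWithinAt
    have h2 := h1.aestronglyMeasurable (μ := volume) hC.measurableSet.compl
    rwa [Measure.restrict_eq_self_of_ae_mem] at h2
    exact hC.ae_notMem volume
  have hbound : ∀ t, ‖r t‖ ≤ ∑ i ∈ Finset.Icc 1 ℓ, ‖rv i‖ := by
    intro t
    obtain ⟨i, h1, h2, k, h3, h4⟩ := key t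
    rw [hval i h1 h2 k t h3 h4]
    exact Finset.single_le_sum (f := fun i => ‖rv i‖) (fun j _ => norm_nonneg _)
      (Finset.mem_Icc.2 ⟨h1, h2⟩)
  have hint : ∀ a b : ℝ, IntervalIntegrable r volume a b := by
    intro a b
    refine (intervalIntegrable_const (c := ∑ i ∈ Finset.Icc 1 ℓ, ‖rv i‖)).mono_fun
      hmeas.restrict (Eventually.of_forall fun t => ?_)
    exact (hbound t).trans (le_abs_self _)
  have hgd : ∀ t, t ∉ C → HasDerivAt g (r t) t := by
    intro t ht
    have hg' : g = fun t => ∫ u in (0:ℝ)..t, r u := funext hg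
    rw [hg']
    exact intervalIntegral.integral_hasDerivAt_right (hint 0 t)
      hmeas.stronglyMeasurableAtFilter (hcont t ht)
  refine Set.Countable.measure_zero
    ((aux_bad_countable g r C hC (Tcum ℓ) hPpos hgd hr hper).mono ?_) volume
  rintro t ⟨ht0, hn⟩
  have ht0 : 0 ≤ t := ht0
  simp only [mem_union, mem_ofPred_eq, not_or, not_and, not_forall, not_exists, not_lt] at hn
  obtain ⟨s, hs0, hsP, hs⟩ := hn.1 ht0
  exact ⟨fun s h1 h2 => hn.2 ht0 s h1 h2, s, hs0, hsP, le_antisymm hs (hn.2 ht0 s hs0 hsP)⟩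
end

section
/- Define the sequence (b_n)_{n ≥ 0} by b_0 = 0 and b_{n+1} = (n+1)·(2n+1)!! + (2n+2)·b_n, where (2n+1)!! = ∏_{k=0}^{n} (2k+1). Then for every integer n ≥ 1 there exists a constant C < ∞, depending only on n, such that for all λ ≥ 1 one has |μ_{2n+1}(λ) − b_n·λ^n| ≤ C·λ^{n−1}. -/
/-- The `p`-th central moment `μ_p(λ) = E[(Y_λ - λ)^p]` of a Poisson random
variable `Y_λ` with mean `λ`, written via its probability mass function. -/
noncomputable def poissonCentralMoment (p : ℕ) (lam : ℝ) : ℝ :=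
  ∑' n : ℕ, (Real.exp (-lam) * lam ^ n / (Nat.factorial n)) * ((n : ℝ) - lam) ^ p

open Polynomial in
/-- Polynomials giving the central moments. -/
noncomputable def momPoly : ℕ → ℝ[X]
  | 0 => 1
  | (p + 1) => X * ∑ j : Fin p, C ((p.choose j : ℕ) : ℝ) * momPoly j
termination_by p => p
decreasing_by exact Nat.lt_succ_of_lt j.2

open Polynomial in
theorem momPoly_succ (p : ℕ) : momPoly (p + 1) =
    X * ∑ j ∈ Finset.range p, C ((p.choose j : ℕ) : ℝ) * momPoly j := by
  rw [momPoly, Finset.sum_range]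

theorem mom_summable (l c : ℝ) (p : ℕ) :
    Summable (fun n : ℕ => (Real.exp (-l) * l ^ n / (Nat.factorial n)) * ((n : ℝ) + c) ^ p) := by
  have h := (Real.summable_pow_div_factorial (Real.exp 1 * |l|)).mul_left
    (Real.exp (-l) * (p.factorial * Real.exp |c|))
  refine Summable.of_norm_bounded h (fun n => ?_)
  have h1 : |(n : ℝ) + c| ^ p ≤ p.factorial * Real.exp ((n : ℝ) + |c|) := by
    have h2 : |(n : ℝ) + c| ≤ (n : ℝ) + |c| := by
      simpa using abs_add_le (n : ℝ) c
    have h3 := Real.pow_div_factorial_le_exp ((n : ℝ) + |c|) (by positivity) p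
    rw [div_le_iff₀ (by positivity)] at h3
    calc _ ≤ ((n : ℝ) + |c|) ^ p := by gcongr
      _ ≤ _ := by linarith
  rw [Real.norm_eq_abs, abs_mul, abs_div, abs_mul, abs_pow, abs_pow, Real.abs_exp, Nat.abs_cast]
  calc _ ≤ Real.exp (-l) * |l| ^ n / n.factorial * (p.factorial * Real.exp ((n : ℝ) + |c|)) := by
        gcongr
    _ = _ := by
        rw [Real.exp_add, mul_pow, ← Real.exp_nat_mul, mul_one]; ring

theorem mom_shift (l : ℝ) (p : ℕ) :
    ∑' n : ℕ, (Real.exp (-l) * l ^ n / (Nat.factorial n)) * ((n : ℝ) * ((n : ℝ) - l) ^ p)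
    = l * ∑' n : ℕ, (Real.exp (-l) * l ^ n / (Nat.factorial n)) * ((n : ℝ) - l + 1) ^ p := by
  have hs : Summable (fun n : ℕ => (Real.exp (-l) * l ^ n / (Nat.factorial n)) *
      ((n : ℝ) * ((n : ℝ) - l) ^ p)) := by
    have := (mom_summable l (-l) (p+1)).add ((mom_summable l (-l) p).mul_left l)
    refine this.congr (fun n => ?_)
    ring
  rw [hs.tsum_eq_zero_add, ← tsum_mul_left]
  simp only [Nat.cast_zero, zero_mul, mul_zero, zero_add]
  refine tsum_congr (fun n => ?_)
  rw [Nat.factorial_succ]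
  push_cast
  have : (n.factorial : ℝ) ≠ 0 := by positivity
  have : (n : ℝ) + 1 ≠ 0 := by positivity
  field_simp
  ring

theorem mom_rec (l : ℝ) (p : ℕ) : poissonCentralMoment (p + 1) l =
    l * ∑ j ∈ Finset.range p, (p.choose j : ℝ) * poissonCentralMoment j l := by
  have hsum : ∀ j, Summable (fun n : ℕ => (Real.exp (-l) * l ^ n / (Nat.factorial n)) *
      ((n : ℝ) - l) ^ j) := fun j => mom_summable l (-l) j
  have hs : Summable (fun n : ℕ => (Real.exp (-l) * l ^ n / (Nat.factorial n)) *
      ((n : ℝ) * ((n : ℝ) - l) ^ p)) := by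
    refine ((hsum (p+1)).add ((hsum p).mul_left l)).congr (fun n => ?_)
    ring
  have h1 : poissonCentralMoment (p + 1) l =
      ∑' n : ℕ, (Real.exp (-l) * l ^ n / (Nat.factorial n)) * ((n : ℝ) * ((n : ℝ) - l) ^ p)
      - l * poissonCentralMoment p l := by
    unfold poissonCentralMoment
    rw [← tsum_mul_left, ← hs.tsum_sub ((hsum p).mul_left l)]
    refine tsum_congr (fun n => ?_)
    ring
  have h2 : ∑' n : ℕ, (Real.exp (-l) * l ^ n / (Nat.factorial n)) * ((n : ℝ) - l + 1) ^ p
      = ∑ j ∈ Finset.range (p + 1), (p.choose j : ℝ) * poissonCentralMoment j l := by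
    unfold poissonCentralMoment
    simp_rw [← tsum_mul_left]
    rw [← Summable.tsum_finsetSum (fun j _ => (hsum j).mul_left _)]
    refine tsum_congr (fun n => ?_)
    rw [add_pow, Finset.mul_sum]
    refine Finset.sum_congr rfl (fun j _ => ?_)
    rw [one_pow]; ring
  rw [h1, mom_shift, h2, Finset.sum_range_succ, Nat.choose_self]
  push_cast
  ring

theorem mom_zero (l : ℝ) : poissonCentralMoment 0 l = 1 := by
  unfold poissonCentralMoment
  have h := (NormedSpace.expSeries_div_hasSum_exp l).mul_left (Real.exp (-l))
  rw [← Real.exp_eq_exp_ℝ, ← Real.exp_add, neg_add_cancel, Real.exp_zero] at h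
  rw [← h.tsum_eq]
  refine tsum_congr (fun n => ?_)
  simp [mul_div_assoc]

theorem mom_eval (l : ℝ) (p : ℕ) : poissonCentralMoment p l = (momPoly p).eval l := by
  induction p using Nat.strong_induction_on with
  | _ p ih =>
    cases p with
    | zero => rw [mom_zero, momPoly]; simp
    | succ p =>
      rw [mom_rec, momPoly_succ]
      simp only [Polynomial.eval_mul, Polynomial.eval_X, Polynomial.eval_finsetSum,
        Polynomial.eval_C]
      congr 1
      refine Finset.sum_congr rfl (fun j hj => ?_)
      rw [ih j (by have := Finset.mem_range.1 hj; omega)]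

theorem momPoly_coeff_succ (p k : ℕ) : (momPoly (p + 1)).coeff (k + 1) =
    ∑ j ∈ Finset.range p, (p.choose j : ℝ) * (momPoly j).coeff k := by
  rw [momPoly_succ, Polynomial.coeff_X_mul, Polynomial.finsetSum_coeff]
  simp only [Polynomial.coeff_C_mul]

theorem momPoly_coeff_zero (p k : ℕ) (h : p < 2 * k) : (momPoly p).coeff k = 0 := by
  induction p using Nat.strong_induction_on generalizing k with
  | _ p ih =>
    obtain ⟨k, rfl⟩ : ∃ m, k = m + 1 := ⟨k - 1, by omega⟩
    cases p with
    | zero => rw [momPoly]; simp [Polynomial.coeff_one]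
    | succ p =>
      rw [momPoly_coeff_succ]
      refine Finset.sum_eq_zero (fun j hj => ?_)
      have := Finset.mem_range.1 hj
      rw [ih j (by omega) k (by omega), mul_zero]

theorem momPoly_even (n : ℕ) : (momPoly (2 * n)).coeff n =
    ∏ k ∈ Finset.range n, (2 * (k : ℝ) + 1) := by
  induction n with
  | zero => rw [Nat.mul_zero, momPoly]; simp
  | succ n ih =>
    rw [show 2 * (n + 1) = (2 * n + 1) + 1 by ring, momPoly_coeff_succ, Finset.sum_range_succ,
      Finset.sum_eq_zero, ih, Finset.prod_range_succ, Nat.choose_succ_self_right]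
    · push_cast; ring
    · intro j hj
      have := Finset.mem_range.1 hj
      rw [momPoly_coeff_zero j n (by omega), mul_zero]

theorem momPoly_odd (b : ℕ → ℝ) (hb0 : b 0 = 0)
    (hbrec : ∀ n : ℕ, b (n + 1) =
      ((n : ℝ) + 1) * (∏ k ∈ Finset.range (n + 1), (2 * (k : ℝ) + 1)) +
        (2 * (n : ℝ) + 2) * b n) (n : ℕ) : (momPoly (2 * n + 1)).coeff n = b n := by
  induction n with
  | zero => rw [hb0, momPoly_succ]; simp
  | succ n ih =>
    have hc : (((2 * n + 2).choose (2 * n) : ℕ) : ℝ) = ((n : ℝ) + 1) * (2 * n + 1) := by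
      rw [Nat.choose_symm_add, Nat.cast_choose_two]
      push_cast; ring
    rw [show 2 * (n + 1) + 1 = (2 * n + 1 + 1) + 1 by ring, momPoly_coeff_succ,
      Finset.sum_range_succ, Finset.sum_range_succ,
      Finset.sum_eq_zero, ih, momPoly_even, Nat.choose_succ_self_right, hbrec,
      Finset.prod_range_succ, hc]
    · push_cast; ring
    · intro j hj
      have := Finset.mem_range.1 hj
      rw [momPoly_coeff_zero j n (by omega), mul_zero]

/- Let b₀ = 0 and b_{n+1} = (n+1)·(2n+1)!! + (2n+2)·b_n, where
(2n+1)!! = ∏_{k=0}^{n}(2k+1).  For every n ≥ 1 there is a constant C (depending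
only on n) such that for all λ ≥ 1: |μ_{2n+1}(λ) − b_n·λ^n| ≤ C·λ^{n−1}. -/
theorem stmt_6 (b : ℕ → ℝ) (hb0 : b 0 = 0)
    (hbrec : ∀ n : ℕ, b (n + 1) =
      ((n : ℝ) + 1) * (∏ k ∈ Finset.range (n + 1), (2 * (k : ℝ) + 1)) +
        (2 * (n : ℝ) + 2) * b n)
    (n : ℕ) (hn : 1 ≤ n) :
    ∃ C : ℝ, ∀ lam : ℝ, 1 ≤ lam →
      |poissonCentralMoment (2 * n + 1) lam - b n * lam ^ n| ≤ C * lam ^ (n - 1) := by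
  have hdeg : (momPoly (2 * n + 1)).natDegree < n + 1 := by
    rw [Nat.lt_succ_iff, Polynomial.natDegree_le_iff_coeff_eq_zero]
    intro k hk
    exact momPoly_coeff_zero _ _ (by omega)
  refine ⟨∑ i ∈ Finset.range n, |(momPoly (2 * n + 1)).coeff i|, fun lam hl => ?_⟩
  rw [mom_eval, Polynomial.eval_eq_sum_range' hdeg, Finset.sum_range_succ,
    momPoly_odd b hb0 hbrec, add_sub_cancel_right, Finset.sum_mul]
  refine (Finset.abs_sum_le_sum_abs _ _).trans (Finset.sum_le_sum (fun i hi => ?_))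
  have hi' := Finset.mem_range.1 hi
  rw [abs_mul, abs_of_nonneg (show (0 : ℝ) ≤ lam ^ i by positivity)]
  gcongr
  omega
end

section
/- For every integer p ≥ 2, the p-th central moment of the Poisson distribution is a polynomial in its mean without constant term, of degree at most ⌊p/2⌋: there exist real numbers c_1, …, c_{⌊p/2⌋} such that μ_p(λ) = Σ_{j=1}^{⌊p/2⌋} c_j·λ^j for all λ > 0. -/
open Polynomial in
theorem poisson_aux (p : ℕ) : ∃ P : ℝ[X], P.natDegree ≤ p / 2 ∧ (1 ≤ p → P.coeff 0 = 0) ∧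
    ∀ lam : ℝ, HasSum (fun n : ℕ => (Real.exp (-lam) * lam ^ n / (Nat.factorial n)) *
      ((n : ℝ) - lam) ^ p) (P.eval lam) := by
  induction p using Nat.strong_induction_on with
  | _ p ih =>
  cases p with
  | zero =>
    refine ⟨1, by simp, by simp, fun lam => ?_⟩
    have h := (NormedSpace.expSeries_div_hasSum_exp (𝔸 := ℝ) lam).mul_left (Real.exp (-lam))
    rw [← Real.exp_eq_exp_ℝ, ← Real.exp_add] at h
    simpa [mul_div_assoc] using h
  | succ p =>
    choose! Q hdeg hc hs using ih
    refine ⟨X * ∑ k ∈ Finset.range p, C (p.choose k : ℝ) * Q k, ?_, by simp, fun lam => ?_⟩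
    · rcases Nat.eq_zero_or_pos p with rfl | hp
      · simp
      · refine natDegree_mul_le.trans ?_
        have : (∑ k ∈ Finset.range p, C (p.choose k : ℝ) * Q k).natDegree ≤ (p - 1) / 2 := by
          refine natDegree_sum_le_of_forall_le _ _ fun k hk => ?_
          have hk' := Finset.mem_range.1 hk
          refine (natDegree_C_mul_le _ _).trans ((hdeg k (by omega)).trans ?_)
          omega
        rw [natDegree_X]
        omega
    · have h1 : HasSum (fun n : ℕ => lam * ∑ k ∈ Finset.range (p + 1), (p.choose k : ℝ) *
          ((Real.exp (-lam) * lam ^ n / (Nat.factorial n)) * ((n : ℝ) - lam) ^ k))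
          (lam * ∑ k ∈ Finset.range (p + 1), (p.choose k : ℝ) * (Q k).eval lam) := by
        refine HasSum.mul_left _ (hasSum_sum fun k hk => HasSum.mul_left _ ?_)
        exact hs k (Finset.mem_range.1 hk) lam
      have h2 : HasSum (fun n : ℕ => (Real.exp (-lam) * lam ^ n / (Nat.factorial n)) *
          ((n : ℝ) * ((n : ℝ) - lam) ^ p))
          (lam * ∑ k ∈ Finset.range (p + 1), (p.choose k : ℝ) * (Q k).eval lam) := by
        rw [← hasSum_nat_add_iff' 1]
        simp only [Finset.range_one, Finset.sum_singleton, Nat.cast_zero, zero_mul, mul_zero,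
          sub_zero]
        refine (congrArg (fun f : ℕ → ℝ => HasSum f _) (funext fun n => ?_)).mpr h1
        have e : ((n + 1 : ℕ) : ℝ) - lam = ((n : ℝ) - lam) + 1 := by push_cast; ring
        rw [e, add_pow, Finset.mul_sum, Finset.mul_sum, Finset.mul_sum]
        refine Finset.sum_congr rfl fun k _ => ?_
        rw [Nat.factorial_succ]
        have : (Nat.factorial n : ℝ) ≠ 0 := by positivity
        have : (n : ℝ) + 1 ≠ 0 := by positivity
        push_cast
        field_simp
        simp only [one_pow, mul_one]
        ring
      have h3 := h2.sub ((hs p (by omega) lam).mul_left lam)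
      have e : (X * ∑ k ∈ Finset.range p, C (p.choose k : ℝ) * Q k).eval lam =
          lam * ∑ k ∈ Finset.range (p + 1), (p.choose k : ℝ) * (Q k).eval lam -
            lam * (Q p).eval lam := by
        rw [Finset.sum_range_succ]
        simp [eval_finsetSum]
        ring
      rw [e]
      refine (congrArg (fun f : ℕ → ℝ => HasSum f _) (funext fun n => ?_)).mpr h3
      ring

theorem stmt_7 (p : ℕ) (hp : 2 ≤ p) :
    ∃ c : ℕ → ℝ, ∀ lam : ℝ, 0 < lam →
      poissonCentralMoment p lam = ∑ j ∈ Finset.Icc 1 (p / 2), c j * lam ^ j := by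
  obtain ⟨P, hd, h0, hs⟩ := poisson_aux p
  refine ⟨P.coeff, fun lam _ => ?_⟩
  rw [poissonCentralMoment, (hs lam).tsum_eq,
    Polynomial.eval_eq_sum_range' (Nat.lt_succ_of_le hd)]
  symm
  apply Finset.sum_subset
  · intro j hj
    simp only [Finset.mem_Icc] at hj
    simp only [Finset.mem_range]
    omega
  · intro j hj hj'
    simp only [Finset.mem_Icc] at hj'
    simp only [Finset.mem_range] at hj
    have : j = 0 := by omega
    subst this
    rw [h0 (by omega), zero_mul]
end

section
/- For every ρ ∈ (0, 1/2), the series Σ_{k=1}^{∞} ((2k)! / ((k−1)!·(k+1)!)) · ρ^k · (1−ρ)^{k+1} converges and equals ρ/(1−2ρ). -/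
lemma cb_conv (n : ℕ) :
    ∑ i ∈ Finset.range (n + 1), (Nat.centralBinom i : ℝ) * Nat.centralBinom (n - i) = 4 ^ n := by
  induction n with
  | zero => simp
  | succ n ih =>
    have key : ∀ i : ℕ, ((i : ℝ) + 1) * Nat.centralBinom (i + 1)
        = 2 * (2 * i + 1) * Nat.centralBinom i := by
      intro i
      exact_mod_cast Nat.succ_mul_centralBinom_succ i
    set S := ∑ i ∈ Finset.range (n + 1 + 1),
      (Nat.centralBinom i : ℝ) * Nat.centralBinom (n + 1 - i) with hS
    have e1 : ∑ i ∈ Finset.range (n + 1 + 1),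
        (i : ℝ) * ((Nat.centralBinom i : ℝ) * Nat.centralBinom (n + 1 - i))
        = ∑ i ∈ Finset.range (n + 1),
          2 * (2 * i + 1) * ((Nat.centralBinom i : ℝ) * Nat.centralBinom (n - i)) := by
      rw [Finset.sum_range_succ']
      simp only [Nat.cast_zero, zero_mul, add_zero]
      refine Finset.sum_congr rfl fun i _ => ?_
      rw [Nat.add_sub_add_right]
      push_cast
      rw [← mul_assoc, key, mul_assoc]
    have refl1 : ∀ m : ℕ, 2 * ∑ i ∈ Finset.range (m + 1),
        (i : ℝ) * ((Nat.centralBinom i : ℝ) * Nat.centralBinom (m - i))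
        = m * ∑ i ∈ Finset.range (m + 1),
          (Nat.centralBinom i : ℝ) * Nat.centralBinom (m - i) := by
      intro m
      rw [two_mul]
      nth_rewrite 1 [← Finset.sum_range_reflect]
      rw [← Finset.sum_add_distrib, Finset.mul_sum]
      refine Finset.sum_congr rfl fun i hi => ?_
      have hi' : i ≤ m := by simpa [Nat.lt_succ_iff] using hi
      have a1 : m + 1 - 1 - i = m - i := by omega
      have a2 : m - (m - i) = i := by omega
      rw [a1, a2, Nat.cast_sub hi']
      ring
    have h1 := refl1 (n + 1)
    have h2 := refl1 n
    rw [e1] at h1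
    have e2 : ∑ i ∈ Finset.range (n + 1),
          2 * (2 * (i : ℝ) + 1) * ((Nat.centralBinom i : ℝ) * Nat.centralBinom (n - i))
        = 4 * ∑ i ∈ Finset.range (n + 1),
            (i : ℝ) * ((Nat.centralBinom i : ℝ) * Nat.centralBinom (n - i))
          + 2 * ∑ i ∈ Finset.range (n + 1),
            (Nat.centralBinom i : ℝ) * Nat.centralBinom (n - i) := by
      rw [Finset.mul_sum, Finset.mul_sum, ← Finset.sum_add_distrib]
      refine Finset.sum_congr rfl fun i _ => by ring
    rw [e2] at h1
    rw [ih] at h1 h2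
    rw [← hS] at h1
    push_cast at h1
    have hn : (n : ℝ) + 1 ≠ 0 := by positivity
    apply mul_left_cancel₀ hn
    rw [← h1, pow_succ]
    linear_combination 4 * h2

lemma cb_hasSum (ρ : ℝ) (h0 : 0 < ρ) (h1 : ρ < 1 / 2) :
    HasSum (fun k : ℕ => (Nat.centralBinom k : ℝ) * (ρ * (1 - ρ)) ^ k) (1 / (1 - 2 * ρ)) := by
  set x := ρ * (1 - ρ) with hx
  have hx0 : 0 < x := mul_pos h0 (by linarith)
  have hx1 : 4 * x < 1 := by nlinarith [sq_pos_of_pos (show 0 < 1 - 2 * ρ by linarith)]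
  have hg := hasSum_geometric_of_lt_one (by positivity : 0 ≤ 4 * x) hx1
  have hnn : ∀ k : ℕ, 0 ≤ (Nat.centralBinom k : ℝ) * x ^ k := fun k => by positivity
  have hs : Summable (fun k : ℕ => (Nat.centralBinom k : ℝ) * x ^ k) := by
    refine Summable.of_nonneg_of_le hnn (fun k => ?_) hg.summable
    have hk : (Nat.centralBinom k : ℝ) ≤ 4 ^ k := by
      exact_mod_cast Nat.centralBinom_le_four_pow k
    have hk2 : (Nat.centralBinom k : ℝ) * x ^ k ≤ (4 * x) ^ k := by
      rw [mul_pow 4 x]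
      exact mul_le_mul_of_nonneg_right hk (pow_nonneg hx0.le k)
    exact hk2
  have hn : Summable (fun k : ℕ => ‖(Nat.centralBinom k : ℝ) * x ^ k‖) := hs.norm
  have hp := tsum_mul_tsum_eq_tsum_sum_range_of_summable_norm hn hn
  have hc : ∀ n : ℕ, ∑ k ∈ Finset.range (n + 1), (Nat.centralBinom k : ℝ) * x ^ k *
      ((Nat.centralBinom (n - k) : ℝ) * x ^ (n - k)) = (4 * x) ^ n := by
    intro n
    rw [mul_pow 4 x, ← cb_conv, Finset.sum_mul]
    refine Finset.sum_congr rfl fun i hi => ?_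
    have hi' : i ≤ n := by simpa [Nat.lt_succ_iff] using hi
    rw [← pow_mul_pow_sub x hi']
    ring
  simp only [hc] at hp
  rw [hg.tsum_eq] at hp
  have hF : 0 ≤ ∑' k : ℕ, (Nat.centralBinom k : ℝ) * x ^ k := tsum_nonneg hnn
  have hr : 0 < 1 - 2 * ρ := by linarith
  have : ∑' k : ℕ, (Nat.centralBinom k : ℝ) * x ^ k = 1 / (1 - 2 * ρ) := by
    refine (mul_self_inj hF (by positivity)).1 ?_
    rw [hp, show 1 - 4 * x = (1 - 2 * ρ) * (1 - 2 * ρ) by rw [hx]; ring]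
    field_simp
  rw [← this]
  exact hs.hasSum

lemma coeff_eq (k : ℕ) :
    ((Nat.factorial (2 * (k + 1)) : ℝ) / (Nat.factorial k * Nat.factorial (k + 2)))
      = (Nat.centralBinom (k + 2) : ℝ) / 2 - Nat.centralBinom (k + 1) := by
  have h := Nat.succ_mul_centralBinom_succ (k + 1)
  have h' : ((k : ℝ) + 2) * Nat.centralBinom (k + 2)
      = 2 * (2 * (k + 1) + 1) * Nat.centralBinom (k + 1) := by
    have : (((k + 1 + 1) * Nat.centralBinom (k + 1 + 1) : ℕ) : ℝ) = _ := congrArg Nat.cast h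
    push_cast at this
    linear_combination this
  have hb : (Nat.centralBinom (k + 1) : ℝ) * (Nat.factorial (k + 1) * Nat.factorial (k + 1))
      = Nat.factorial (2 * (k + 1)) := by
    have := Nat.choose_mul_factorial_mul_factorial (show k + 1 ≤ 2 * (k + 1) by omega)
    rw [show 2 * (k + 1) - (k + 1) = k + 1 by omega, ← Nat.centralBinom_eq_two_mul_choose,
      mul_assoc] at this
    exact_mod_cast this
  have hk : (0 : ℝ) < Nat.factorial k := by positivity
  have e : (Nat.centralBinom (k + 2) : ℝ)
      = 2 * (2 * (k + 1) + 1) * Nat.centralBinom (k + 1) / (k + 2) := by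
    field_simp
    linear_combination h'
  rw [← hb, e, Nat.factorial_succ (k + 1), Nat.factorial_succ k]
  push_cast
  field_simp
  ring

/- For every ρ ∈ (0, 1/2), the series
Σ_{k≥1} ((2k)! / ((k−1)!·(k+1)!)) · ρ^k · (1−ρ)^{k+1} converges and equals
ρ/(1−2ρ).  (Reindexed below by k ↦ k+1 so the sum runs over all of ℕ.) -/
theorem stmt_10 (ρ : ℝ) (h0 : 0 < ρ) (h1 : ρ < 1 / 2) :
    HasSum (fun k : ℕ =>
      ((Nat.factorial (2 * (k + 1)) : ℝ) / (Nat.factorial k * Nat.factorial (k + 2))) *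
        ρ ^ (k + 1) * (1 - ρ) ^ (k + 2)) (ρ / (1 - 2 * ρ)) := by
  have hF := cb_hasSum ρ h0 h1
  have A1 := (hasSum_nat_add_iff' 1).2 hF
  have A2 := (hasSum_nat_add_iff' 2).2 hF
  have hr : 1 - 2 * ρ ≠ 0 := by linarith
  have hq : 1 - ρ ≠ 0 := by linarith
  have hc2 : Nat.centralBinom 1 = 2 := by decide
  have := (A2.mul_left (1 / (2 * ρ))).sub (A1.mul_left (1 - ρ))
  have hv : 1 / (2 * ρ) * (1 / (1 - 2 * ρ) -
        ∑ i ∈ Finset.range 2, (Nat.centralBinom i : ℝ) * (ρ * (1 - ρ)) ^ i) -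
      (1 - ρ) * (1 / (1 - 2 * ρ) -
        ∑ i ∈ Finset.range 1, (Nat.centralBinom i : ℝ) * (ρ * (1 - ρ)) ^ i)
      = ρ / (1 - 2 * ρ) := by
    simp only [Finset.sum_range_succ, Finset.sum_range_zero, hc2, Nat.centralBinom_zero]
    push_cast
    field_simp
    ring
  rw [hv] at this
  refine Eq.mp (congrArg (fun f : ℕ → ℝ => HasSum f (ρ / (1 - 2 * ρ))) (funext fun k => ?_)) this
  symm
  rw [coeff_eq]
  simp only [mul_pow]
  field_simp
  ring
end

section
/- Let 0 < b < d be real numbers and set ρ = b/(b+d). Then the series Σ_{k=1}^{∞} ((2k)! / ((k−1)!·(k+1)!)) · ρ^k · (1−ρ)^{k+1} converges and equals b/(d−b). -/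
theorem aux_series (p : ℝ) (hp : 0 < p) (hp2 : p < 1 / 2) :
    ∃ S C : ℝ, HasSum (fun k : ℕ => (Nat.centralBinom k : ℝ) * (p * (1 - p)) ^ k) S ∧
      HasSum (fun k : ℕ => (catalan k : ℝ) * (p * (1 - p)) ^ k) C ∧
      S * (1 - 2 * p) = 1 ∧ C * (1 - p) = 1 := by
  obtain ⟨x, hx⟩ : ∃ x, x = p * (1 - p) := ⟨_, rfl⟩
  rw [← hx]
  have hx0 : 0 < x := by rw [hx]; exact mul_pos hp (by linarith)
  have hx4 : 4 * x < 1 := by rw [hx]; nlinarith [mul_pos (sub_pos.2 hp2) (sub_pos.2 hp2)]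
  have hg : Summable (fun k : ℕ => (4 * x) ^ k) :=
    summable_geometric_of_lt_one (by positivity) hx4
  have hSs : Summable (fun k : ℕ => (Nat.centralBinom k : ℝ) * x ^ k) := by
    refine Summable.of_nonneg_of_le (fun k => by positivity) (fun k => ?_) hg
    rw [mul_pow]
    have : (Nat.centralBinom k : ℝ) ≤ 4 ^ k := by
      exact_mod_cast Nat.centralBinom_le_four_pow k
    gcongr
  have hcat : ∀ k : ℕ, ((k : ℝ) + 1) * catalan k = Nat.centralBinom k := fun k => by
    exact_mod_cast succ_mul_catalan_eq_centralBinom k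
  have hCs : Summable (fun k : ℕ => (catalan k : ℝ) * x ^ k) := by
    refine Summable.of_nonneg_of_le (fun k => by positivity) (fun k => ?_) hSs
    have : (catalan k : ℝ) ≤ Nat.centralBinom k := by
      rw [← hcat k]
      have : (0 : ℝ) ≤ k * catalan k := by positivity
      linarith
    gcongr
  obtain ⟨S, hS⟩ := hSs
  obtain ⟨C, hC⟩ := hCs
  refine ⟨S, C, hS, hC, ?_⟩
  have hS1 : 0 < S := by
    have := le_hasSum hS 0 (fun j _ => by positivity)
    simp at this
    linarith
  -- linear relation
  have hlin : 2 * x * C = 4 * x * S - (S - 1) := by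
    have h1 := (hasSum_nat_add_iff' 1).2 hS
    have h2 := (hS.mul_left (4 * x)).sub h1
    have h3 := hC.mul_left (2 * x)
    have h4 : (fun k : ℕ => 2 * x * ((catalan k : ℝ) * x ^ k)) = fun k : ℕ =>
        4 * x * ((Nat.centralBinom k : ℝ) * x ^ k) - (Nat.centralBinom (k + 1) : ℝ) * x ^ (k + 1) := by
      funext k
      have h5 : ((k : ℝ) + 1) * Nat.centralBinom (k + 1) = 2 * (2 * k + 1) * Nat.centralBinom k := by
        exact_mod_cast Nat.succ_mul_centralBinom_succ k
      rw [← hcat k] at h5 ⊢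
      have h6 : (Nat.centralBinom (k + 1) : ℝ) = 2 * (2 * k + 1) * catalan k := by
        apply mul_left_cancel₀ (show (k : ℝ) + 1 ≠ 0 by positivity)
        rw [h5]; ring
      rw [h6, pow_succ]; ring
    rw [h4] at h3
    have := h3.unique h2
    simpa using this
  have hquad : C = 1 + x * C ^ 2 := by
    have h1 := (hasSum_nat_add_iff' 1).2 hC
    have hn : Summable (fun k : ℕ => ‖(catalan k : ℝ) * x ^ k‖) := hC.summable.norm
    have h2 := tsum_mul_tsum_eq_tsum_sum_antidiagonal_of_summable_norm hn hn
    rw [hC.tsum_eq] at h2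
    have h3 := h1.tsum_eq
    have h4 : ∀ k : ℕ, (catalan (k + 1) : ℝ) * x ^ (k + 1) =
        x * ∑ ij ∈ Finset.HasAntidiagonal.antidiagonal k,
          (catalan ij.1 : ℝ) * x ^ ij.1 * ((catalan ij.2 : ℝ) * x ^ ij.2) := by
      intro k
      rw [catalan_succ']
      push_cast
      rw [Finset.sum_mul, Finset.mul_sum]
      refine Finset.sum_congr rfl (fun ij hij => ?_)
      rw [← Finset.HasAntidiagonal.mem_antidiagonal.1 hij]
      ring
    simp only [h4] at h3
    rw [tsum_mul_left, ← h2] at h3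
    simp at h3
    linarith
  have hr : (1 - 2 * x * C) ^ 2 = (1 - 2 * p) ^ 2 := by
    have : (1 - 2 * x * C) ^ 2 = 1 - 4 * x * (C - x * C ^ 2) := by ring
    rw [this, show C - x * C ^ 2 = 1 by linarith, hx]; ring
  have hrp : 0 ≤ 1 - 2 * x * C := by
    have : 1 - 2 * x * C = (1 - 4 * x) * S := by linarith
    rw [this]; exact mul_nonneg (by linarith) hS1.le
  have hr2 : 1 - 2 * x * C = 1 - 2 * p :=
    (pow_left_inj₀ hrp (by linarith) two_ne_zero).1 hr
  have hxC : x * C = p := by linarith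
  constructor
  · have h : (1 - 2 * p) * (S * (1 - 2 * p)) = (1 - 2 * p) * 1 := by
      have : 4 * x = 1 - (1 - 2 * p) ^ 2 := by rw [hx]; ring
      have h5 : (1 - 4 * x) * S = 1 - 2 * p := by linarith
      rw [this] at h5; linarith
    exact mul_left_cancel₀ (by linarith) h
  · rw [hx] at hxC
    exact mul_left_cancel₀ hp.ne' (by linarith)

/- Let 0 < b < d and ρ = b/(b+d).  The series
Σ_{k≥1} ((2k)! / ((k−1)!·(k+1)!)) · ρ^k · (1−ρ)^{k+1} converges and equals
b/(d−b).  (Reindexed below by k ↦ k+1 so the sum runs over all of ℕ.) -/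
theorem stmt_11 (b d : ℝ) (hb : 0 < b) (hbd : b < d) :
    HasSum (fun k : ℕ =>
      ((Nat.factorial (2 * (k + 1)) : ℝ) / (Nat.factorial k * Nat.factorial (k + 2))) *
        (b / (b + d)) ^ (k + 1) * (1 - b / (b + d)) ^ (k + 2)) (b / (d - b)) := by
  have hs : 0 < b + d := by linarith
  have hp : 0 < b / (b + d) := by positivity
  have hp2 : b / (b + d) < 1 / 2 := by
    rw [div_lt_div_iff₀ hs two_pos]; linarith
  have hval : b / (d - b) = b / (b + d) / (1 - 2 * (b / (b + d))) := by
    have h1 : d - b ≠ 0 := by linarith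
    have h2 : 1 - 2 * (b / (b + d)) = (d - b) / (b + d) := by field_simp; ring
    rw [h2]; field_simp
  rw [hval]
  generalize b / (b + d) = p at *
  obtain ⟨S, C, hS, hC, hS1, hC1⟩ := aux_series p hp hp2
  have h := ((hasSum_nat_add_iff' 1).2 (hS.sub hC)).mul_left (1 - p)
  convert h using 1
  · rfl
  · funext k
    have hc : ((Nat.factorial (2 * (k + 1)) : ℝ) / (Nat.factorial k * Nat.factorial (k + 2)))
        = Nat.centralBinom (k + 1) - catalan (k + 1) := by
      have h1 : (((k + 1 : ℕ) : ℝ) + 1) * catalan (k + 1) = Nat.centralBinom (k + 1) := by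
        exact_mod_cast succ_mul_catalan_eq_centralBinom (k + 1)
      have h2 : (Nat.centralBinom (k + 1) : ℝ) * (Nat.factorial (k + 1)) * (Nat.factorial (k + 1))
          = Nat.factorial (2 * (k + 1)) := by
        have := Nat.choose_mul_factorial_mul_factorial (n := 2 * (k + 1)) (k := k + 1) (by omega)
        rw [show 2 * (k + 1) - (k + 1) = k + 1 by omega] at this
        exact_mod_cast this
      rw [← h2, ← h1, Nat.factorial_succ (k + 1), Nat.factorial_succ k]
      have := Nat.factorial_ne_zero k
      push_cast
      field_simp
      ring
    rw [hc, mul_pow, pow_succ (1 - p) (k + 1)]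
    ring
  · simp only [Finset.sum_range_one, Nat.centralBinom_zero, catalan_zero, pow_zero]
    rw [div_eq_iff (by linarith)]
    push_cast
    linear_combination (-(1 - p)) * hS1 + (1 - 2 * p) * hC1
end

section
/- For all positive real constants C₁, C₂, C₃, ε, p, q there exist a constant C < ∞ and K₀ ∈ ℕ such that for every natural number K ≥ K₀: K^{p+q+1}·C₁·exp(−C₂·ε²·K) + Σ_{l=⌈K^{p+q+1}⌉}^{∞} ( 4·(1 − exp(−C₃·K^{p+1}/l))^{1/2} )^{l} ≤ C·K^{−q}. In particular, for K large enough the series on the left converges. -/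
/- For all positive constants C₁, C₂, C₃, ε, p, q there exist C < ∞ and K₀ such
that for all K ≥ K₀ the series Σ_{l ≥ ⌈K^{p+q+1}⌉} (4(1−e^{−C₃K^{p+1}/l})^{1/2})^l
converges and
K^{p+q+1}·C₁·e^{−C₂ε²K} + Σ_{l ≥ ⌈K^{p+q+1}⌉} (4(1−e^{−C₃K^{p+1}/l})^{1/2})^l ≤ C·K^{−q}. -/
theorem stmt_13 (C₁ C₂ C₃ ε p q : ℝ)
    (h1 : 0 < C₁) (h2 : 0 < C₂) (h3 : 0 < C₃) (hε : 0 < ε) (hp : 0 < p) (hq : 0 < q) :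
    ∃ C : ℝ, ∃ K₀ : ℕ, ∀ K : ℕ, K₀ ≤ K →
      Summable (fun l : ℕ => if ⌈(K : ℝ) ^ (p + q + 1)⌉₊ ≤ l then
          (4 * Real.sqrt (1 - Real.exp (-C₃ * (K : ℝ) ^ (p + 1) / l))) ^ l else 0) ∧
      (K : ℝ) ^ (p + q + 1) * C₁ * Real.exp (-C₂ * ε ^ 2 * K) +
          (∑' l : ℕ, if ⌈(K : ℝ) ^ (p + q + 1)⌉₊ ≤ l then
            (4 * Real.sqrt (1 - Real.exp (-C₃ * (K : ℝ) ^ (p + 1) / l))) ^ l else 0)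
        ≤ C * (K : ℝ) ^ (-q) := by
  have hb : 0 < C₂ * ε ^ 2 := by positivity
  have hl2 : 0 < Real.log 2 := Real.log_pos (by norm_num)
  have e1 := ((tendsto_rpow_mul_exp_neg_mul_atTop_nhds_zero (p + q + 1 + q) _ hb).comp
    (tendsto_natCast_atTop_atTop (R := ℝ))).eventually_le_const (show (0:ℝ) < 1 by norm_num)
  have e2 := ((tendsto_rpow_mul_exp_neg_mul_atTop_nhds_zero q _ hl2).comp
    (tendsto_natCast_atTop_atTop (R := ℝ))).eventually_le_const (show (0:ℝ) < 1 by norm_num)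
  have e3 := ((tendsto_rpow_atTop hq).comp
    (tendsto_natCast_atTop_atTop (R := ℝ))).eventually_ge_atTop (256 * C₃)
  obtain ⟨K₀, hK₀⟩ := Filter.eventually_atTop.1
    (((e1.and e2).and e3).and (Filter.eventually_ge_atTop 1))
  refine ⟨C₁ + 2, K₀, fun K hK => ?_⟩
  obtain ⟨⟨⟨a1, a2⟩, a3⟩, a4⟩ := hK₀ K hK
  simp only [Function.comp] at a1 a2 a3
  have hK1 : (1:ℝ) ≤ K := by exact_mod_cast a4
  have hK0 : (0:ℝ) < K := by linarith
  have hKq : (0:ℝ) < (K:ℝ) ^ q := Real.rpow_pos_of_pos hK0 q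
  have key : ∀ l : ℕ, (0:ℝ) ≤ (if ⌈(K : ℝ) ^ (p + q + 1)⌉₊ ≤ l then
          (4 * Real.sqrt (1 - Real.exp (-C₃ * (K : ℝ) ^ (p + 1) / l))) ^ l else 0) ∧
      (if ⌈(K : ℝ) ^ (p + q + 1)⌉₊ ≤ l then
          (4 * Real.sqrt (1 - Real.exp (-C₃ * (K : ℝ) ^ (p + 1) / l))) ^ l else 0)
        ≤ (1/2:ℝ) ^ K * (1/2:ℝ) ^ l := by
    intro l
    split_ifs with h
    · refine ⟨by positivity, ?_⟩
      have hml : (K:ℝ) ^ (p + q + 1) ≤ l := Nat.ceil_le.1 h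
      have hKl : (K:ℝ) ≤ l := by
        refine le_trans ?_ hml
        conv_lhs => rw [← Real.rpow_one (K:ℝ)]
        exact Real.rpow_le_rpow_of_exponent_le hK1 (by linarith)
      have hKl' : K ≤ l := by exact_mod_cast hKl
      have hl0 : (0:ℝ) < l := by linarith
      have hsplit : (K:ℝ) ^ (p + q + 1) = (K:ℝ) ^ (p + 1) * (K:ℝ) ^ q := by
        rw [← Real.rpow_add hK0]; congr 1; ring
      have hP : (0:ℝ) < (K:ℝ) ^ (p + 1) := Real.rpow_pos_of_pos hK0 _
      have hx : C₃ * (K:ℝ) ^ (p + 1) / l ≤ 1 / 256 := by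
        rw [div_le_div_iff₀ hl0 (by norm_num)]
        have := mul_le_mul_of_nonneg_left a3 hP.le
        linarith
      have hex := Real.add_one_le_exp (-C₃ * (K : ℝ) ^ (p + 1) / l)
      have hneg : -C₃ * (K : ℝ) ^ (p + 1) / l = -(C₃ * (K:ℝ) ^ (p + 1) / l) := by ring
      have hs : Real.sqrt (1 - Real.exp (-C₃ * (K : ℝ) ^ (p + 1) / l)) ≤ 1 / 16 := by
        rw [Real.sqrt_le_left (by norm_num)]
        rw [hneg] at hex ⊢
        linarith
      calc (4 * Real.sqrt (1 - Real.exp (-C₃ * (K : ℝ) ^ (p + 1) / l))) ^ l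
          ≤ (1/2 * (1/2) : ℝ) ^ l := by
            apply pow_le_pow_left₀ (by positivity)
            linarith
        _ = (1/2:ℝ) ^ l * (1/2:ℝ) ^ l := mul_pow _ _ _
        _ ≤ _ := by
            apply mul_le_mul_of_nonneg_right _ (by positivity)
            exact pow_le_pow_of_le_one (by norm_num) (by norm_num) hKl'
    · exact ⟨le_rfl, by positivity⟩
  have hg : Summable (fun l : ℕ => (1/2:ℝ) ^ K * (1/2:ℝ) ^ l) :=
    summable_geometric_two.mul_left _
  have hsum := Summable.of_nonneg_of_le (fun l => (key l).1) (fun l => (key l).2) hg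
  refine ⟨hsum, ?_⟩
  have hle := hsum.tsum_le_tsum (fun l => (key l).2) hg
  rw [tsum_mul_left, tsum_geometric_two] at hle
  have hexp : Real.exp (-Real.log 2 * K) = (1/2:ℝ) ^ K := by
    rw [mul_comm, Real.exp_nat_mul, Real.exp_neg, Real.exp_log (by norm_num)]; norm_num
  rw [hexp] at a2
  have b2 : (1/2:ℝ) ^ K ≤ (K:ℝ) ^ (-q) := by
    rw [Real.rpow_neg hK0.le, ← one_div, le_div_iff₀ hKq]; linarith
  have b1 : (K:ℝ) ^ (p + q + 1) * Real.exp (-C₂ * ε ^ 2 * K) ≤ (K:ℝ) ^ (-q) := by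
    rw [Real.rpow_neg hK0.le, ← one_div, le_div_iff₀ hKq]
    rw [Real.rpow_add hK0 (p + q + 1) q] at a1
    have : -C₂ * ε ^ 2 * K = -(C₂ * ε ^ 2) * K := by ring
    rw [this]; linarith
  have := mul_le_mul_of_nonneg_left b1 h1.le
  linarith
end
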